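/- Theorem (fourth Costas cube family): Let q > 3 be a prime power, and suppose there exists a primitive element φ of the finite field F_q for which both 1 − φ and 1 − φ^{−1} are also primitive. Then the (q−3)×(q−3)×(q−3) array E = (e_{i,j,k}) given by e_{i,j,k} = I[φ^{i+1} + (1−φ)^{j+1} = 1 and φ^i + (1−φ^{−1})^{k+1} = 1 and (1−φ)^j + (1−φ^{−1})^k = 1] for i, j, k ∈ {1, 2, …, q−3}, where the equations are over F_q, is an order q−3 Costas cube; moreover Projection A of E is the G3(q, φ) Golomb Costas array, Projection B of E is the reflection through a vertical axis of the G3(q, φ^{−1}) Golomb Costas array, and Projection C of E is the rotation through 180° of the G3(q, (1−φ)^{−1}) Golomb Costas array. -/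

import Mathlib

/-- An order `n` permutation array: an `n × n` array with entries in `{0,1}`,
indexed by `{1, …, n}`, such that every row and every column contains exactly one `1`. -/
def IsPermArray (n : ℕ) (s : ℕ → ℕ → ℕ) : Prop :=
  (∀ i ∈ Finset.Icc 1 n, ∀ j ∈ Finset.Icc 1 n, s i j = 0 ∨ s i j = 1) ∧
  (∀ i ∈ Finset.Icc 1 n, ∑ j ∈ Finset.Icc 1 n, s i j = 1) ∧
  (∀ j ∈ Finset.Icc 1 n, ∑ i ∈ Finset.Icc 1 n, s i j = 1)

/-- An order `n` Costas array: a permutation array in which the vectors joining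
pairs of `1` entries are all distinct. -/
def IsCostasArray (n : ℕ) (s : ℕ → ℕ → ℕ) : Prop :=
  IsPermArray n s ∧
  ∀ i1 ∈ Finset.Icc 1 n, ∀ j1 ∈ Finset.Icc 1 n,
  ∀ i2 ∈ Finset.Icc 1 n, ∀ j2 ∈ Finset.Icc 1 n,
  ∀ i3 ∈ Finset.Icc 1 n, ∀ j3 ∈ Finset.Icc 1 n,
  ∀ i4 ∈ Finset.Icc 1 n, ∀ j4 ∈ Finset.Icc 1 n,
    s i1 j1 = 1 → s i2 j2 = 1 → s i3 j3 = 1 → s i4 j4 = 1 →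
    ((i2 : ℤ) - (i1 : ℤ), (j2 : ℤ) - (j1 : ℤ)) =
      ((i4 : ℤ) - (i3 : ℤ), (j4 : ℤ) - (j3 : ℤ)) →
    ((i2 : ℤ) - (i1 : ℤ), (j2 : ℤ) - (j1 : ℤ)) ≠ (0, 0) →
    (i1, j1) = (i3, j3)

/-- A primitive element of a finite field: a generator of its multiplicative group. -/
def IsPrimitiveElt {F : Type*} [Field F] [Fintype F] (φ : F) : Prop :=
  orderOf φ = Fintype.card F - 1

/-- Projection A of a three-dimensional array: `a i j = ∑ k, d i j k`. -/
def ProjA (n : ℕ) (d : ℕ → ℕ → ℕ → ℕ) (i j : ℕ) : ℕ := ∑ k ∈ Finset.Icc 1 n, d i j k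

/-- Projection B of a three-dimensional array: `b i k = ∑ j, d i j k`. -/
def ProjB (n : ℕ) (d : ℕ → ℕ → ℕ → ℕ) (i k : ℕ) : ℕ := ∑ j ∈ Finset.Icc 1 n, d i j k

/-- Projection C of a three-dimensional array: `c j k = ∑ i, d i j k`. -/
def ProjC (n : ℕ) (d : ℕ → ℕ → ℕ → ℕ) (j k : ℕ) : ℕ := ∑ i ∈ Finset.Icc 1 n, d i j k

/-- An order `n` Costas cube: an `n × n × n` array over `ℤ₂` whose three
projections are each order `n` Costas arrays. -/
def IsCostasCube (n : ℕ) (d : ℕ → ℕ → ℕ → ℕ) : Prop :=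
  (∀ i ∈ Finset.Icc 1 n, ∀ j ∈ Finset.Icc 1 n, ∀ k ∈ Finset.Icc 1 n,
      d i j k = 0 ∨ d i j k = 1) ∧
  IsCostasArray n (ProjA n d) ∧ IsCostasArray n (ProjB n d) ∧ IsCostasArray n (ProjC n d)

open Finset

lemma IsPrimitiveElt.isPrimitiveRoot {F : Type*} [Field F] [Fintype F] {g : F}
    (hg : IsPrimitiveElt g) : IsPrimitiveRoot g (Fintype.card F - 1) := by
  rw [← show orderOf g = Fintype.card F - 1 from hg]
  exact IsPrimitiveRoot.orderOf g

lemma IsPrimitiveElt.pow_inj {F : Type*} [Field F] [Fintype F] {g : F}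
    (hg : IsPrimitiveElt g) {i j : ℕ} (hi : i ∈ Icc 1 (Fintype.card F - 3))
    (hj : j ∈ Icc 1 (Fintype.card F - 3)) (h : g ^ i = g ^ j) : i = j := by
  rw [mem_Icc] at hi hj
  exact hg.isPrimitiveRoot.pow_inj (by omega) (by omega) h

lemma IsPrimitiveElt.exists_pow_eq_iff {F : Type*} [Field F] [Fintype F] {g : F}
    (hg : IsPrimitiveElt g) {x : F} :
    (∃ i ∈ Icc 1 (Fintype.card F - 3), g ^ i = x) ↔ x ≠ 0 ∧ x ≠ 1 ∧ g * x ≠ 1 := by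
  have hq := Fintype.one_lt_card (α := F)
  have hr := hg.isPrimitiveRoot
  constructor
  · rintro ⟨i, hi, rfl⟩
    rw [mem_Icc] at hi
    refine ⟨pow_ne_zero _ (hr.ne_zero (by omega)),
      hr.pow_ne_one_of_pos_of_lt (by omega) (by omega), ?_⟩
    rw [← pow_succ']
    exact hr.pow_ne_one_of_pos_of_lt (by omega) (by omega)
  · rintro ⟨h0, h1, h2⟩
    have : NeZero (Fintype.card F - 1) := ⟨by omega⟩
    obtain ⟨i, hi, rfl⟩ := hr.eq_pow_of_pow_eq_one (FiniteField.pow_card_sub_one_eq_one x h0)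
    refine ⟨i, mem_Icc.2 ⟨?_, ?_⟩, rfl⟩
    · by_contra h
      exact h1 (by rw [show i = 0 by omega, pow_zero])
    · by_contra h
      refine h2 ?_
      rw [← pow_succ', show i + 1 = Fintype.card F - 1 by omega, hr.pow_eq_one]

/-- The inverse of a primitive element `g` satisfies `g⁻¹ ^ (q - 1 - i) = g ^ i`. -/
lemma IsPrimitiveElt.inv_pow_sub {F : Type*} [Field F] [Fintype F] {g : F}
    (hg : IsPrimitiveElt g) {i : ℕ} (hi : i ∈ Icc 1 (Fintype.card F - 3)) :
    g⁻¹ ^ (Fintype.card F - 2 - i + 1) = g ^ i := by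
  have hq := Fintype.one_lt_card (α := F)
  rw [mem_Icc] at hi
  rw [inv_pow]
  refine inv_eq_of_mul_eq_one_right ?_
  rw [← pow_add, show Fintype.card F - 2 - i + 1 + i = Fintype.card F - 1 by omega]
  exact hg.isPrimitiveRoot.pow_eq_one

lemma sum_ite_eq_one {ι : Type*} {s : Finset ι} {P : ι → Prop} [DecidablePred P]
    (hex : ∃ k ∈ s, P k) (huniq : ∀ k ∈ s, ∀ l ∈ s, P k → P l → k = l) :
    ∑ k ∈ s, (if P k then 1 else 0) = 1 := by
  obtain ⟨k, hk, hPk⟩ := hex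
  rw [sum_eq_single_of_mem k hk fun l hl hlk => if_neg fun hPl => hlk (huniq l hl k hk hPl hPk),
    if_pos hPk]

/-- An array of Golomb type, supported on `α * a ^ i + β * b ^ j = 1`, is a Costas array as soon
as every row and every column is nonempty. -/
lemma isCostasArray_of_forall_eq_ite {F : Type*} [Field F] [Fintype F] [DecidableEq F]
    {a b α β : F} (ha : IsPrimitiveElt a) (hb : IsPrimitiveElt b) (hα : α ≠ 0) (hβ : β ≠ 0)
    {s : ℕ → ℕ → ℕ}
    (hs : ∀ i ∈ Icc 1 (Fintype.card F - 3), ∀ j ∈ Icc 1 (Fintype.card F - 3),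
      s i j = if α * a ^ i + β * b ^ j = 1 then 1 else 0)
    (hrow : ∀ i ∈ Icc 1 (Fintype.card F - 3),
      ∃ j ∈ Icc 1 (Fintype.card F - 3), α * a ^ i + β * b ^ j = 1)
    (hcol : ∀ j ∈ Icc 1 (Fintype.card F - 3),
      ∃ i ∈ Icc 1 (Fintype.card F - 3), α * a ^ i + β * b ^ j = 1) :
    IsCostasArray (Fintype.card F - 3) s := by
  refine ⟨⟨fun i hi j hj => ?_, fun i hi => ?_, fun j hj => ?_⟩, ?_⟩
  · rw [hs i hi j hj]
    split_ifs <;> simp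
  · rw [sum_congr rfl fun j hj => hs i hi j hj]
    refine sum_ite_eq_one (hrow i hi) fun k hk l hl hPk hPl => hb.pow_inj hk hl ?_
    exact mul_left_cancel₀ hβ (add_left_cancel (hPk.trans hPl.symm))
  · rw [sum_congr rfl fun i hi => hs i hi j hj]
    refine sum_ite_eq_one (hcol j hj) fun k hk l hl hPk hPl => ha.pow_inj hk hl ?_
    exact mul_left_cancel₀ hα (add_right_cancel (hPk.trans hPl.symm))
  · intro i1 hi1 j1 hj1 i2 hi2 j2 hj2 i3 hi3 j3 hj3 i4 hi4 j4 hj4 h1 h2 h3 h4 heq hne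
    rw [hs _ ‹_› _ ‹_›] at h1 h2 h3 h4
    replace h1 : α * a ^ i1 + β * b ^ j1 = 1 := by by_contra h; simp [h] at h1
    replace h2 : α * a ^ i2 + β * b ^ j2 = 1 := by by_contra h; simp [h] at h2
    replace h3 : α * a ^ i3 + β * b ^ j3 = 1 := by by_contra h; simp [h] at h3
    replace h4 : α * a ^ i4 + β * b ^ j4 = 1 := by by_contra h; simp [h] at h4
    -- two points with the same first coordinate coincide
    have key : ∀ i ∈ Icc 1 (Fintype.card F - 3), ∀ j ∈ Icc 1 (Fintype.card F - 3),
        α * a ^ i + β * b ^ j = 1 → α * a ^ i1 = α * a ^ i → i1 = i ∧ j1 = j := by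
      intro i hi j hj h hx
      refine ⟨ha.pow_inj hi1 hi (mul_left_cancel₀ hα hx), hb.pow_inj hj1 hj ?_⟩
      exact mul_left_cancel₀ hβ (by linear_combination h1 - h - hx)
    simp only [Prod.mk.injEq] at heq
    have hA : a ^ i2 * a ^ i3 = a ^ i1 * a ^ i4 := by
      rw [← pow_add, ← pow_add, show i2 + i3 = i1 + i4 by omega]
    have hB : b ^ j2 * b ^ j3 = b ^ j1 * b ^ j4 := by
      rw [← pow_add, ← pow_add, show j2 + j3 = j1 + j4 by omega]
    generalize hx1 : α * a ^ i1 = x1 at *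
    generalize hx2 : α * a ^ i2 = x2 at *
    generalize hx3 : α * a ^ i3 = x3 at *
    generalize hx4 : α * a ^ i4 = x4 at *
    have hP : x2 * x3 = x1 * x4 := by
      rw [← hx1, ← hx2, ← hx3, ← hx4]
      linear_combination α ^ 2 * hA
    have hQ : (1 - x2) * (1 - x3) = (1 - x1) * (1 - x4) := by
      have e1 : 1 - x1 = β * b ^ j1 := by linear_combination -h1
      have e2 : 1 - x2 = β * b ^ j2 := by linear_combination -h2
      have e3 : 1 - x3 = β * b ^ j3 := by linear_combination -h3
      have e4 : 1 - x4 = β * b ^ j4 := by linear_combination -h4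
      rw [e1, e2, e3, e4]
      linear_combination β ^ 2 * hB
    have hprod : (x1 - x2) * (x1 - x3) = 0 := by
      linear_combination (1 - x1) * hP + x1 * hQ
    rcases mul_eq_zero.1 hprod with h | h
    · obtain ⟨rfl, rfl⟩ := key i2 hi2 j2 hj2 (by rw [hx2, h2]) (by rw [hx2, sub_eq_zero.1 h])
      simp at hne
    · obtain ⟨rfl, rfl⟩ := key i3 hi3 j3 hj3 (by rw [hx3, h3]) (by rw [hx3, sub_eq_zero.1 h])
      rfl

/-- Every row of the array supported on `α * a ^ i + β * b ^ j = 1` is nonempty when the line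
`α * x + β * y = 1` meets `y ∈ {0, 1, b⁻¹}` only at points with `x ∈ {0, 1, a⁻¹}`. -/
lemma exists_mem_Icc_mul_pow_add_mul_pow {F : Type*} [Field F] [Fintype F]
    {a b α β : F} (ha : IsPrimitiveElt a) (hb : IsPrimitiveElt b) (hβ : β ≠ 0)
    (hex : ∀ x y : F, α * x + β * y = 1 → y = 0 ∨ y = 1 ∨ b * y = 1 →
      x = 0 ∨ x = 1 ∨ a * x = 1) {i : ℕ} (hi : i ∈ Icc 1 (Fintype.card F - 3)) :
    ∃ j ∈ Icc 1 (Fintype.card F - 3), α * a ^ i + β * b ^ j = 1 := by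
  have hy : α * a ^ i + β * ((1 - α * a ^ i) / β) = 1 := by field_simp; ring
  have hx := ha.exists_pow_eq_iff.1 ⟨i, hi, rfl⟩
  have hn := mt (hex _ _ hy) (by tauto)
  obtain ⟨j, hj, hje⟩ := (hb.exists_pow_eq_iff (x := (1 - α * a ^ i) / β)).2 (by tauto)
  exact ⟨j, hj, by rw [hje, hy]⟩

/-- Fourth Costas cube family: for a prime power `q > 3` and a primitive element `φ`
of `𝔽_q` with `1 − φ` and `1 − φ⁻¹` also primitive, the array
`e i j k = I[φ^(i+1) + (1−φ)^(j+1) = 1 ∧ φ^i + (1−φ⁻¹)^(k+1) = 1 ∧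
(1−φ)^j + (1−φ⁻¹)^k = 1]` for `i, j, k ∈ {1, …, q−3}` is an order `q − 3` Costas
cube, whose Projection A is the `G₃(q, φ)` Golomb Costas array, Projection B is the
reflection through a vertical axis of the `G₃(q, φ⁻¹)` Golomb Costas array, and
Projection C is the rotation through 180° of the `G₃(q, (1−φ)⁻¹)` Golomb Costas
array. -/
theorem fourth_costas_cube_family (q : ℕ) (hq : 3 < q) (F : Type*) [Field F] [Fintype F]
    [DecidableEq F] (hcard : Fintype.card F = q) (φ : F)
    (hφ : IsPrimitiveElt φ) (hφ1 : IsPrimitiveElt (1 - φ))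
    (hφ2 : IsPrimitiveElt (1 - φ⁻¹))
    (e : ℕ → ℕ → ℕ → ℕ)
    (he : e = fun i j k =>
      if φ ^ (i + 1) + (1 - φ) ^ (j + 1) = 1 ∧
          φ ^ i + (1 - φ⁻¹) ^ (k + 1) = 1 ∧
          (1 - φ) ^ j + (1 - φ⁻¹) ^ k = 1
      then 1 else 0) :
    IsCostasCube (q - 3) e ∧
    (∀ i ∈ Finset.Icc 1 (q - 3), ∀ j ∈ Finset.Icc 1 (q - 3),
      ProjA (q - 3) e i j =
        if φ ^ (i + 1) + (1 - φ) ^ (j + 1) = 1 then 1 else 0) ∧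
    (∀ i ∈ Finset.Icc 1 (q - 3), ∀ k ∈ Finset.Icc 1 (q - 3),
      ProjB (q - 3) e i k =
        if (φ⁻¹) ^ ((q - 2 - i) + 1) + (1 - φ⁻¹) ^ (k + 1) = 1 then 1 else 0) ∧
    (∀ j ∈ Finset.Icc 1 (q - 3), ∀ k ∈ Finset.Icc 1 (q - 3),
      ProjC (q - 3) e j k =
        if ((1 - φ)⁻¹) ^ ((q - 2 - j) + 1) + (1 - (1 - φ)⁻¹) ^ ((q - 2 - k) + 1) = 1
        then 1 else 0) := by
  subst hcard
  have ha0 : φ ≠ 0 := hφ.isPrimitiveRoot.ne_zero (by omega)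
  have hb0 : 1 - φ ≠ 0 := hφ1.isPrimitiveRoot.ne_zero (by omega)
  have hc0 : 1 - φ⁻¹ ≠ 0 := hφ2.isPrimitiveRoot.ne_zero (by omega)
  have hac : φ * (1 - φ⁻¹) = -(1 - φ) := by field_simp; ring
  have hbc : 1 - (1 - φ)⁻¹ = (1 - φ⁻¹)⁻¹ := by
    refine eq_inv_of_mul_eq_one_left ?_
    field_simp
    ring
  have hab : φ + (1 - φ) = 1 := by ring
  generalize 1 - φ⁻¹ = c at *
  generalize 1 - φ = b at *
  generalize φ = a at *
  set S := Icc 1 (Fintype.card F - 3)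
  -- the three equations are linearly dependent
  have h12 : ∀ {x y z : F}, a * x + b * y = 1 → 1 * x + c * z = 1 → 1 * y + 1 * z = 1 :=
    fun {x y z} h1 h2 => mul_left_cancel₀ hb0 (by linear_combination h1 - a * h2 + z * hac - hab)
  have h13 : ∀ {x y z : F}, a * x + b * y = 1 → 1 * y + 1 * z = 1 → 1 * x + c * z = 1 :=
    fun {x y z} h1 h3 => mul_left_cancel₀ ha0 (by linear_combination h1 - b * h3 + z * hac - hab)
  have rowA : ∀ i ∈ S, ∃ j ∈ S, a * a ^ i + b * b ^ j = 1 := fun i hi =>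
    exists_mem_Icc_mul_pow_add_mul_pow hφ hφ1 hb0 (by
      rintro x y h (rfl | rfl | hy)
      · exact .inr (.inr (by linear_combination h))
      · exact .inr (.inl (mul_left_cancel₀ ha0 (by linear_combination h - hab)))
      · exact .inl (mul_left_cancel₀ ha0 (by linear_combination h - hy))) hi
  have colA : ∀ j ∈ S, ∃ i ∈ S, a * a ^ i + b * b ^ j = 1 := fun j hj => by
    simp_rw [add_comm (a * _)]
    exact exists_mem_Icc_mul_pow_add_mul_pow hφ1 hφ ha0 (by
      rintro x y h (rfl | rfl | hy)
      · exact .inr (.inr (by linear_combination h))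
      · exact .inr (.inl (mul_left_cancel₀ hb0 (by linear_combination h - hab)))
      · exact .inl (mul_left_cancel₀ hb0 (by linear_combination h - hy))) hj
  have rowB : ∀ i ∈ S, ∃ k ∈ S, 1 * a ^ i + c * c ^ k = 1 := fun i hi =>
    exists_mem_Icc_mul_pow_add_mul_pow hφ hφ2 hc0 (by
      rintro x y h (rfl | rfl | hy)
      · exact .inr (.inl (by linear_combination h))
      · exact .inr (.inr (by linear_combination a * h - hac + hab))
      · exact .inl (by linear_combination h - hy)) hi
  have colB : ∀ k ∈ S, ∃ i ∈ S, 1 * a ^ i + c * c ^ k = 1 := fun k hk => by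
    simp_rw [add_comm ((1 : F) * _)]
    exact exists_mem_Icc_mul_pow_add_mul_pow hφ2 hφ one_ne_zero (by
      rintro x y h (rfl | rfl | hy)
      · exact .inr (.inr (by linear_combination h))
      · exact .inl (mul_left_cancel₀ hc0 (by linear_combination h))
      · exact .inr (.inl (mul_left_cancel₀ hb0
          (by linear_combination -a * h + x * hac + hy - hab)))) hk
  have rowC : ∀ j ∈ S, ∃ k ∈ S, 1 * b ^ j + 1 * c ^ k = 1 := fun j hj => by
    obtain ⟨i, hi, h1⟩ := colA j hj
    obtain ⟨k, hk, h2⟩ := rowB i hi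
    exact ⟨k, hk, h12 h1 h2⟩
  have colC : ∀ k ∈ S, ∃ j ∈ S, 1 * b ^ j + 1 * c ^ k = 1 := fun k hk => by
    obtain ⟨i, hi, h2⟩ := colB k hk
    obtain ⟨j, hj, h1⟩ := rowA i hi
    exact ⟨j, hj, h12 h1 h2⟩
  replace he : ∀ i j k, e i j k =
      if a * a ^ i + b * b ^ j = 1 ∧ 1 * a ^ i + c * c ^ k = 1 ∧ 1 * b ^ j + 1 * c ^ k = 1
      then 1 else 0 := fun i j k => by simp only [he, pow_succ', one_mul]
  have projA : ∀ i ∈ S, ∀ j ∈ S, ProjA (Fintype.card F - 3) e i j =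
      if a * a ^ i + b * b ^ j = 1 then 1 else 0 := fun i hi j hj => by
    simp only [ProjA, he]
    split_ifs with h
    · obtain ⟨k, hk, h2⟩ := rowB i hi
      exact sum_ite_eq_one ⟨k, hk, h, h2, h12 h h2⟩ fun k hk l hl hPk hPl =>
        hφ2.pow_inj hk hl (by linear_combination hPk.2.2 - hPl.2.2)
    · exact sum_eq_zero fun k _ => if_neg fun hk => h hk.1
  have projB : ∀ i ∈ S, ∀ k ∈ S, ProjB (Fintype.card F - 3) e i k =
      if 1 * a ^ i + c * c ^ k = 1 then 1 else 0 := fun i hi k hk => by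
    simp only [ProjB, he]
    split_ifs with h
    · obtain ⟨j, hj, h1⟩ := rowA i hi
      exact sum_ite_eq_one ⟨j, hj, h1, h, h12 h1 h⟩ fun j hj l hl hPj hPl =>
        hφ1.pow_inj hj hl (by linear_combination hPj.2.2 - hPl.2.2)
    · exact sum_eq_zero fun j _ => if_neg fun hj => h hj.2.1
  have projC : ∀ j ∈ S, ∀ k ∈ S, ProjC (Fintype.card F - 3) e j k =
      if 1 * b ^ j + 1 * c ^ k = 1 then 1 else 0 := fun j hj k hk => by
    simp only [ProjC, he]
    split_ifs with h
    · obtain ⟨i, hi, h1⟩ := colA j hj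
      exact sum_ite_eq_one ⟨i, hi, h1, h13 h1 h, h⟩ fun i hi l hl hPi hPl =>
        hφ.pow_inj hi hl (by linear_combination hPi.2.1 - hPl.2.1)
    · exact sum_eq_zero fun i _ => if_neg fun hi => h hi.2.2
  refine ⟨⟨fun i _ j _ k _ => ?_,
    isCostasArray_of_forall_eq_ite hφ hφ1 ha0 hb0 projA rowA colA,
    isCostasArray_of_forall_eq_ite hφ hφ2 one_ne_zero hc0 projB rowB colB,
    isCostasArray_of_forall_eq_ite hφ1 hφ2 one_ne_zero one_ne_zero projC rowC colC⟩,
    fun i hi j hj => ?_, fun i hi k hk => ?_, fun j hj k hk => ?_⟩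
  · rw [he]
    split_ifs <;> simp
  · rw [projA i hi j hj, pow_succ' a, pow_succ' b]
  · rw [projB i hi k hk, hφ.inv_pow_sub hi, one_mul, pow_succ' c]
  · rw [projC j hj k hk, hφ1.inv_pow_sub hj, hbc, hφ2.inv_pow_sub hk, one_mul, one_mul]
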